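/- Let h ≥ 1 with h % 8 = 4, let β be a positive definite symmetric ℚ-bilinear form on V := Fin h → ℚ, and let L ⊆ V be an odd unimodular integral lattice with respect to β. Then the set of unimodular integral lattices N ⊆ V with N ⊓ L = M₂(L) has exactly two elements, and every such N is odd. -/

import Mathlib

/-- `L` is a unimodular integral lattice w.r.t. `β` if it equals its dual lattice
`L^∨ = {v | ∀ x ∈ L, β v x ∈ ℤ}`. -/
def IsUnimodularLattice {h : ℕ} (β : (Fin h → ℚ) →ₗ[ℚ] (Fin h → ℚ) →ₗ[ℚ] ℚ)
    (L : Submodule ℤ (Fin h → ℚ)) : Prop :=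
  ∀ v : Fin h → ℚ, v ∈ L ↔ ∀ x ∈ L, ∃ n : ℤ, β v x = (n : ℚ)

/-- `L` is odd: `β x x` is an odd integer for some `x ∈ L`. -/
def IsOddLattice {h : ℕ} (β : (Fin h → ℚ) →ₗ[ℚ] (Fin h → ℚ) →ₗ[ℚ] ℚ)
    (L : Submodule ℤ (Fin h → ℚ)) : Prop :=
  ∃ x ∈ L, ∃ n : ℤ, Odd n ∧ β x x = (n : ℚ)

/-- `L` is even: `β x x` is an even integer for every `x ∈ L`. -/
def IsEvenLattice {h : ℕ} (β : (Fin h → ℚ) →ₗ[ℚ] (Fin h → ℚ) →ₗ[ℚ] ℚ)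
    (L : Submodule ℤ (Fin h → ℚ)) : Prop :=
  ∀ x ∈ L, ∃ n : ℤ, Even n ∧ β x x = (n : ℚ)

/-- The index-two sublattice `M₂(L) = {x ∈ L | β x x is an even integer}` (as a set). -/
def M2set {h : ℕ} (β : (Fin h → ℚ) →ₗ[ℚ] (Fin h → ℚ) →ₗ[ℚ] ℚ)
    (L : Submodule ℤ (Fin h → ℚ)) : Set (Fin h → ℚ) :=
  {x | x ∈ L ∧ ∃ n : ℤ, Even n ∧ β x x = (n : ℚ)}


open Complex in
lemma vdb_half_pow (r : ℝ) (hr : 0 < r) :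
    ((r : ℂ) * (1 - I)) ^ (1 / 2 : ℂ) ≠ 0 ∧
    ∃ t : ℝ, 0 < t ∧ ((r : ℂ) * (1 - I)) ^ (1 / 2 : ℂ) = t * cexp (-(Real.pi * I / 8)) := by
  have h1 : (r : ℂ) * (1 - I) = ((r * √2 : ℝ) : ℂ) * cexp (((-(Real.pi / 4) : ℝ) : ℂ) * I) := by
    rw [exp_mul_I, ← ofReal_cos, ← ofReal_sin, Real.cos_neg, Real.sin_neg,
      Real.cos_pi_div_four, Real.sin_pi_div_four]
    have : (√2 : ℂ) * √2 = 2 := by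
      rw [← ofReal_mul]; norm_num
    push_cast
    linear_combination (-(r : ℂ) * (1 - I) / 2) * this
  have hpos : 0 < r * √2 := by positivity
  have h2 : ((r : ℂ) * (1 - I)) ^ (1 / 2 : ℂ)
      = ((r * √2) ^ (1 / 2 : ℝ) : ℝ) * cexp (-(Real.pi * I / 8)) := by
    have hne : (r : ℂ) * (1 - I) ≠ 0 := by
      rw [h1]
      exact mul_ne_zero (by exact_mod_cast hpos.ne') (exp_ne_zero _)
    rw [cpow_def_of_ne_zero hne, h1, log_ofReal_mul hpos (exp_ne_zero _), log_exp,
      Real.rpow_def_of_pos hpos, ofReal_exp, ← Complex.exp_add]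
    · congr 1
      push_cast
      ring
    · simp; linarith [Real.pi_pos]
    · simp; linarith [Real.pi_pos]
  refine ⟨?_, _, by positivity, h2⟩
  rw [h2]
  refine mul_ne_zero ?_ (exp_ne_zero _)
  have : 0 < (r * √2) ^ (1 / 2 : ℝ) := by positivity
  exact_mod_cast this.ne'

open Complex in
lemma vdb_summable (a b : ℂ) (ha : 0 < a.re) :
    Summable (fun n : ℤ => cexp (-Real.pi * a * n ^ 2 + 2 * Real.pi * b * n)) := by
  have := (summable_jacobiTheta₂_term_iff (-I * b) (I * a)).2 (by simpa using ha)
  refine this.congr fun n => ?_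
  rw [jacobiTheta₂_term]
  congr 1
  linear_combination (2 * Real.pi * n * b - Real.pi * n ^ 2 * a) * (- I_sq)

open Complex in
lemma vdb_real (r : ℝ) (hr : 0 < r) :
    ∃ t : ℝ, 0 < t ∧ (∑' n : ℤ, cexp (-Real.pi * r * n ^ 2)) = t := by
  have hs := vdb_summable r 0 (by simpa using hr)
  have hs' : Summable (fun n : ℤ => Real.exp (-Real.pi * r * n ^ 2)) := by
    rw [← summable_ofReal]
    refine hs.congr fun n => ?_
    push_cast
    simp
  refine ⟨∑' n : ℤ, Real.exp (-Real.pi * r * n ^ 2), hs'.tsum_pos (fun _ => (Real.exp_pos _).le) 0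
    (Real.exp_pos _), ?_⟩
  push_cast
  rfl

open Complex in
lemma vdb_exp_int (z w : ℂ) (n : ℤ) (h : z = w + n * (2 * Real.pi * I)) : cexp z = cexp w := by
  rw [exp_eq_exp_iff_exists_int]
  exact ⟨n, h⟩

lemma vdb_box_shift {ι : Type*} [Fintype ι] [DecidableEq ι] (d : ι → ℕ) [∀ i, NeZero (d i)]
    (F : (ι → ℤ) → ℂ)
    (hF : ∀ k t : ι → ℤ, F (fun i => k i + d i * t i) = F k) (m : ι → ℤ) :
    ∑ k : (∀ i, ZMod (d i)), F (fun i => ((k i).val : ℤ) + m i)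
      = ∑ k : (∀ i, ZMod (d i)), F (fun i => ((k i).val : ℤ)) := by
  refine Fintype.sum_equiv (Equiv.addRight (fun i => (m i : ZMod (d i)))) _ _ fun k => ?_
  have : ∀ i, ∃ t : ℤ, ((k i).val : ℤ) + m i
      = (((Equiv.addRight (fun i => (m i : ZMod (d i)))) k i).val : ℤ) + d i * t := by
    intro i
    have h1 : (((((k i).val : ℤ) + m i
      - (((Equiv.addRight (fun i => (m i : ZMod (d i)))) k i).val : ℤ)) : ℤ) : ZMod (d i)) = 0 := by
      push_cast
      simp
    rw [ZMod.intCast_zmod_eq_zero_iff_dvd] at h1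
    obtain ⟨t, ht⟩ := h1
    exact ⟨t, by linarith⟩
  choose t ht using this
  exact (congrArg F (funext ht)).trans (hF _ t)

lemma vdb_shift1 (d : ℕ) [NeZero d] (F : ℤ → ℂ)
    (hF : ∀ k t : ℤ, F (k + d * t) = F k) (m : ℤ) :
    ∑ k : ZMod d, F ((k.val : ℤ) + m) = ∑ k : ZMod d, F (k.val : ℤ) := by
  refine Fintype.sum_equiv (Equiv.addRight (m : ZMod d)) _ _ fun k => ?_
  have h1 : (((((k).val : ℤ) + m
      - (((Equiv.addRight (m : ZMod d)) k).val : ℤ)) : ℤ) : ZMod d) = 0 := by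
    push_cast
    simp
  rw [ZMod.intCast_zmod_eq_zero_iff_dvd] at h1
  obtain ⟨t, ht⟩ := h1
  refine Eq.trans (congrArg F ?_) (hF _ t)
  linarith

lemma vdb_residue (d : ℕ) [NeZero d] (f : ℤ → ℂ) (hf : Summable f) :
    ∑' n, f n = ∑ k : ZMod d, ∑' m : ℤ, f (m * d + k.val) := by
  rw [← (Int.divModEquiv d).symm.tsum_eq f]
  have h2 : Summable (fun p : ℤ × Fin d => f ((Int.divModEquiv d).symm p)) :=
    (Int.divModEquiv d).symm.summable_iff.2 hf
  rw [← (Equiv.prodComm (Fin d) ℤ).tsum_eq]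
  have h3 := (Equiv.prodComm (Fin d) ℤ).summable_iff.2 h2
  refine (h3.tsum_prod' (fun b => h3.comp_injective (Prod.mk_right_injective b))).trans ?_
  rw [tsum_fintype]
  obtain ⟨e, rfl⟩ := Nat.exists_eq_succ_of_ne_zero (NeZero.ne d)
  refine Finset.sum_congr rfl fun k _ => tsum_congr fun m => ?_
  simp [Int.divModEquiv]
  rfl

open Complex in
lemma vdb_gauss (d : ℕ) [NeZero d] (hd : Even d) :
    ∃ r : ℝ, 0 < r ∧ ∑ k : ZMod d, cexp (Real.pi * I * ((k.val : ℤ) : ℂ) ^ 2 / d)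
      = r * cexp (Real.pi * I / 4) := by
  obtain ⟨c, hc⟩ := hd
  have hd0 : 0 < (d : ℝ) := by exact_mod_cast NeZero.pos d
  have hdC : (d : ℂ) ≠ 0 := by exact_mod_cast NeZero.ne d
  have hcC : (d : ℂ) = 2 * c := by rw [hc]; push_cast; ring
  have h1I : (1 - I) ≠ 0 := by
    intro h
    have := congrArg re h
    simp at this
  set α : ℂ := ((1 / (2 * d) : ℝ) : ℂ) * (1 - I) with hα
  set γ : ℂ := ((1 / d : ℝ) : ℂ) * (1 - I) with hγ
  have hα' : α = (1 - I) / (2 * d) := by rw [hα]; push_cast; ring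
  have hγ' : γ = (1 - I) / d := by rw [hγ]; push_cast; ring
  have hαre : 0 < α.re := by
    rw [hα, re_ofReal_mul]; exact mul_pos (by positivity) (by simp)
  have hγre : 0 < γ.re := by
    rw [hγ, re_ofReal_mul]; exact mul_pos (by positivity) (by simp)
  obtain ⟨hα0, tα, htα, hαe⟩ := vdb_half_pow (1 / (2 * d)) (by positivity)
  obtain ⟨hγ0, tγ, htγ, hγe⟩ := vdb_half_pow (1 / d) (by positivity)
  rw [← hα] at hα0 hαe
  rw [← hγ] at hγ0 hγe
  have hinv : 1 / (1 - I) = (1 + I) / 2 := by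
    field_simp
    linear_combination I_sq
  have hαi : 1 / α = d * (1 + I) := by
    rw [hα', one_div_div]
    linear_combination (2 * d : ℂ) * hinv
  have hγi : 1 / γ = d * (1 + I) / 2 := by
    rw [hγ', one_div_div]
    linear_combination (d : ℂ) * hinv
  set T : ℂ := ∑' n : ℤ, cexp (-Real.pi * α * n ^ 2) with hT
  obtain ⟨R1, hR1, hR1e⟩ := vdb_real d hd0
  obtain ⟨R2, hR2, hR2e⟩ := vdb_real (1 / d) (by positivity)
  have e1 : T = 1 / α ^ (1 / 2 : ℂ) * R1 := by
    rw [hT, Complex.tsum_exp_neg_mul_int_sq hαre, ← hR1e]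
    congr 1
    refine tsum_congr fun n => vdb_exp_int _ _ (-c * n ^ 2) ?_
    rw [div_eq_mul_one_div, hαi]
    push_cast
    rw [hcC]
    ring
  set g : ℂ := ∑ k : ZMod d, cexp (Real.pi * I * ((k.val : ℤ) : ℂ) ^ 2 / d) with hg
  have e2 : T = γ ^ (1 / 2 : ℂ) * (g * R2) := by
    have hsT : Summable (fun n : ℤ => cexp (-Real.pi * α * n ^ 2)) := by
      simpa using vdb_summable α 0 hαre
    rw [hT, vdb_residue d _ hsT]
    have inner : ∀ k : ZMod d, ∑' m : ℤ, cexp (-Real.pi * α * ((m * d + k.val : ℤ) : ℂ) ^ 2)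
        = γ ^ (1 / 2 : ℂ) * ∑' n : ℤ, cexp (-Real.pi * ((1 / d : ℝ) : ℂ) * n ^ 2) *
            cexp (Real.pi * I * (((k.val : ℤ) + -n : ℤ) : ℂ) ^ 2 / d) := by
      intro k
      have hP := Complex.tsum_exp_neg_quadratic hγre (-I * k.val / d)
      have h3 : ∑' m : ℤ, cexp (-Real.pi * α * ((m * d + k.val : ℤ) : ℂ) ^ 2)
          = cexp (Real.pi * I * ((k.val : ℤ) : ℂ) ^ 2 / d) *
            ∑' n : ℤ, cexp (-Real.pi / γ * (n + I * (-I * k.val / d)) ^ 2) := by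
        rw [← tsum_mul_left]
        refine tsum_congr fun m => ?_
        rw [← Complex.exp_add]
        refine vdb_exp_int _ _ (c * m ^ 2 + m * k.val) ?_
        rw [div_eq_mul_one_div (-(Real.pi : ℂ)) γ, hγi, hα']
        have hI : I * (-I * (k.val : ℂ) / d) = k.val / d := by
          linear_combination (-(k.val : ℂ) / d) * I_sq
        rw [hI]
        push_cast
        have hc2 : (c : ℂ) = d / 2 := by rw [hcC]; ring
        rw [hc2]
        field_simp
        ring
      have h4 : ∑' n : ℤ, cexp (-Real.pi / γ * (n + I * (-I * k.val / d)) ^ 2)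
          = γ ^ (1 / 2 : ℂ) *
            ∑' n : ℤ, cexp (-Real.pi * γ * n ^ 2 + 2 * Real.pi * (-I * k.val / d) * n) := by
        rw [hP, ← mul_assoc, mul_one_div_cancel hγ0, one_mul]
      rw [h3, h4, mul_left_comm, ← tsum_mul_left]
      congr 1
      refine tsum_congr fun n => ?_
      rw [← Complex.exp_add, ← Complex.exp_add]
      congr 1
      rw [hγ']
      push_cast
      field_simp
      ring
    rw [Finset.sum_congr rfl fun k _ => inner k, ← Finset.mul_sum]
    congr 1
    have hs2 : ∀ k : ZMod d, Summable (fun n : ℤ => cexp (-Real.pi * ((1 / d : ℝ) : ℂ) * n ^ 2) *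
            cexp (Real.pi * I * (((k.val : ℤ) + -n : ℤ) : ℂ) ^ 2 / d)) := by
      intro k
      have := (vdb_summable γ (-I * k.val / d) hγre).mul_left
        (cexp (Real.pi * I * ((k.val : ℤ) : ℂ) ^ 2 / d))
      refine this.congr fun n => ?_
      rw [← Complex.exp_add, ← Complex.exp_add]
      congr 1
      rw [hγ']
      push_cast
      field_simp
      ring
    rw [← Summable.tsum_finsetSum fun k _ => hs2 k, ← hR2e, ← tsum_mul_left]
    refine tsum_congr fun n => ?_
    rw [← Finset.mul_sum, mul_comm]
    congr 1
    rw [hg]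
    refine vdb_shift1 d (fun x => cexp (Real.pi * I * (x : ℂ) ^ 2 / d)) (fun k t => ?_) (-n)
    refine vdb_exp_int _ _ (k * t + c * t ^ 2) ?_
    push_cast
    have hc2 : (c : ℂ) = d / 2 := by rw [hcC]; ring
    rw [hc2]
    field_simp
    ring
  have hR2' : (R2 : ℂ) ≠ 0 := by exact_mod_cast hR2.ne'
  have e3 : g = R1 / R2 * (1 / (α ^ (1 / 2 : ℂ) * γ ^ (1 / 2 : ℂ))) := by
    rw [e1] at e2
    field_simp
    field_simp at e2
    rw [e2]
    ring
  refine ⟨R1 / R2 * (1 / (tα * tγ)), by positivity, ?_⟩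
  rw [e3, hαe, hγe]
  have : cexp (Real.pi * I / 4) * (cexp (-(Real.pi * I / 8)) * cexp (-(Real.pi * I / 8))) = 1 := by
    rw [← Complex.exp_add, ← Complex.exp_add, ← Complex.exp_zero]
    congr 1
    ring
  have h8 := Complex.exp_ne_zero (-(Real.pi * I / 8))
  have htα' : (tα : ℂ) ≠ 0 := by exact_mod_cast htα.ne'
  have htγ' : (tγ : ℂ) ≠ 0 := by exact_mod_cast htγ.ne'
  rw [show cexp (Real.pi * I / 4) = 1 / (cexp (-(Real.pi * I / 8)) * cexp (-(Real.pi * I / 8))) from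
    eq_one_div_of_mul_eq_one_left this]
  push_cast
  field_simp

/-- `q` is an integer. -/
def vdbInt (q : ℚ) : Prop := ∃ n : ℤ, q = (n : ℚ)

lemma vdbInt.add {p q : ℚ} (hp : vdbInt p) (hq : vdbInt q) : vdbInt (p + q) := by
  obtain ⟨a, rfl⟩ := hp
  obtain ⟨b, rfl⟩ := hq
  exact ⟨a + b, by push_cast; ring⟩

lemma vdbInt.sub {p q : ℚ} (hp : vdbInt p) (hq : vdbInt q) : vdbInt (p - q) := by
  obtain ⟨a, rfl⟩ := hp
  obtain ⟨b, rfl⟩ := hq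
  exact ⟨a - b, by push_cast; ring⟩

lemma vdbInt.mul {p q : ℚ} (hp : vdbInt p) (hq : vdbInt q) : vdbInt (p * q) := by
  obtain ⟨a, rfl⟩ := hp
  obtain ⟨b, rfl⟩ := hq
  exact ⟨a * b, by push_cast; ring⟩

lemma vdbInt.int (n : ℤ) : vdbInt n := ⟨n, rfl⟩

lemma vdbInt.sum {ι : Type*} (s : Finset ι) (f : ι → ℚ) (hf : ∀ i ∈ s, vdbInt (f i)) :
    vdbInt (∑ i ∈ s, f i) := by
  classical
  induction s using Finset.induction_on with
  | empty => exact ⟨0, by simp⟩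
  | insert a s ha ih =>
    rw [Finset.sum_insert ha]
    exact (hf _ (Finset.mem_insert_self _ _)).add
      (ih fun i hi => hf i (Finset.mem_insert_of_mem hi))

section lattice

variable {h : ℕ} (β : (Fin h → ℚ) →ₗ[ℚ] (Fin h → ℚ) →ₗ[ℚ] ℚ)
    (L : Submodule ℤ (Fin h → ℚ))

lemma vdb_int_of_mem (hL : IsUnimodularLattice β L) {x y : Fin h → ℚ} (hx : x ∈ L) (hy : y ∈ L) :
    vdbInt (β x y) := (hL x).1 hx y hy

lemma vdb_smul_mem {z : ℤ} {x : Fin h → ℚ} (hx : x ∈ L) : (z : ℚ) • x ∈ L := by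
  rw [Int.cast_smul_eq_zsmul]
  exact L.smul_mem z hx

lemma vdb_absorb (hsymm : ∀ x y, β x y = β y x) (hpos : ∀ x, x ≠ 0 → 0 < β x x)
    (hL : IsUnimodularLattice β L) (v : Fin h → ℚ) : ∃ n : ℤ, 0 < n ∧ (n : ℚ) • v ∈ L := by
  let B : LinearMap.BilinForm ℚ (Fin h → ℚ) := β
  let W : Submodule ℚ (Fin h → ℚ) := Submodule.span ℚ (L : Set (Fin h → ℚ))
  have hrefl : B.IsRefl := by
    intro x y hxy
    change β y x = 0
    rw [hsymm]
    exact hxy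
  have hdisj : Disjoint W (B.orthogonal W) := by
    rw [Submodule.disjoint_def]
    intro x hx hx'
    by_contra hne
    have h1 := hpos x hne
    have h2 : β x x = 0 := hx' x hx
    linarith
  have hcompl := (LinearMap.BilinForm.isCompl_orthogonal_iff_disjoint hrefl).2 hdisj
  have horth : B.orthogonal W = ⊥ := by
    rw [eq_bot_iff]
    intro v hv
    by_contra hne
    have hne' : v ≠ 0 := fun h0 => hne (by simp [h0])
    have hin : ∀ t : ℚ, t • v ∈ L := by
      intro t
      rw [hL]
      intro x hx
      refine ⟨0, ?_⟩
      have h1 : β x v = 0 := hv x (Submodule.subset_span hx)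
      rw [map_smul, LinearMap.smul_apply, hsymm, h1]
      simp
    have hvL : v ∈ L := by simpa using hin 1
    obtain ⟨n, hn⟩ := vdb_int_of_mem β L hL hvL hvL
    have hn0 : 0 < (n : ℚ) := hn ▸ hpos v hne'
    obtain ⟨m, hm⟩ := vdb_int_of_mem β L hL (hin (1 / (2 * n))) (hin (1 / (2 * n)))
    rw [map_smul, map_smul, LinearMap.smul_apply, smul_eq_mul, smul_eq_mul, hn] at hm
    field_simp at hm
    have h2 : (1 : ℤ) = 2 ^ 2 * n * m := by exact_mod_cast hm
    have h3 : (1 : ℤ) = 4 * (n * m) := by linarith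
    omega
  have hWtop : W = ⊤ := by
    have := hcompl.sup_eq_top
    rwa [horth, sup_bot_eq] at this
  have hv : v ∈ W := hWtop ▸ Submodule.mem_top
  induction hv using Submodule.span_induction with
  | mem x hx => exact ⟨1, one_pos, by simpa using hx⟩
  | zero => exact ⟨1, one_pos, by simp⟩
  | add x y _ _ hx hy =>
    obtain ⟨n, hn, hnx⟩ := hx
    obtain ⟨m, hm, hmy⟩ := hy
    refine ⟨n * m, mul_pos hn hm, ?_⟩
    have h1 := L.add_mem (vdb_smul_mem L (z := m) hnx) (vdb_smul_mem L (z := n) hmy)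
    convert h1 using 1
    push_cast
    module
  | smul a x _ hx =>
    obtain ⟨n, hn, hnx⟩ := hx
    refine ⟨a.den * n, mul_pos (by exact_mod_cast a.den_pos) hn, ?_⟩
    have h1 := vdb_smul_mem L (z := a.num) hnx
    convert h1 using 1
    rw [smul_smul, smul_smul]
    congr 1
    push_cast
    have : a * a.den = a.num := Rat.mul_den_eq_num a
    linear_combination (n : ℚ) * this

lemma vdb_basis (hsymm : ∀ x y, β x y = β y x) (hpos : ∀ x, x ≠ 0 → 0 < β x x)
    (hL : IsUnimodularLattice β L) :
    ∃ (c : Module.Basis (Fin h) ℚ (Fin h → ℚ)) (d : Fin h → ℕ),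
      (∀ i, 0 < d i ∧ Even (d i)) ∧ (∀ i j, β (c i) (c j) = if i = j then 1 / (d i : ℚ) else 0) ∧
      (∀ i, ∃ y ∈ L, (d i : ℚ) • c i = (2 : ℚ) • y) := by
  let B : LinearMap.BilinForm ℚ (Fin h → ℚ) := β
  have hBs : LinearMap.IsSymm B := ⟨fun x y => hsymm x y⟩
  obtain ⟨v', hv'⟩ := LinearMap.BilinForm.exists_orthogonal_basis (B := B) hBs
  let e : Fin (Module.finrank ℚ (Fin h → ℚ)) ≃ Fin h := finCongr (by simp)
  let v := v'.reindex e
  have hv : ∀ i j, i ≠ j → β (v i) (v j) = 0 := by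
    intro i j hij
    simp only [v, Module.Basis.reindex_apply]
    exact hv' (fun hh => hij (e.symm.injective hh))
  choose n hn hnv using fun i => vdb_absorb β L hsymm hpos hL (v i)
  choose z hz using fun i => vdb_int_of_mem β L hL (hnv i) (hnv i)
  have hz0 : ∀ i, 0 < z i := by
    intro i
    have h1 : 0 < β ((n i : ℚ) • v i) ((n i : ℚ) • v i) := by
      apply hpos
      exact smul_ne_zero (by exact_mod_cast (hn i).ne') (v.ne_zero i)
    rw [hz] at h1
    exact_mod_cast h1
  have hzn : ∀ i, ((z i).toNat : ℚ) = z i := by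
    intro i
    have : ((z i).toNat : ℤ) = z i := Int.toNat_of_nonneg (hz0 i).le
    exact_mod_cast this
  have hzq : ∀ i, 0 < (z i : ℚ) := fun i => by exact_mod_cast hz0 i
  have hnq : ∀ i, 0 < (n i : ℚ) := fun i => by exact_mod_cast hn i
  let a : Fin h → ℚ := fun i => n i / (2 * z i)
  have ha : ∀ i, a i ≠ 0 := fun i => (div_pos (hnq i) (by have := hzq i; positivity)).ne'
  refine ⟨v.unitsSMul fun i => Units.mk0 (a i) (ha i), fun i => 4 * (z i).toNat, ?_, ?_, ?_⟩
  · intro i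
    have := hz0 i
    exact ⟨by change 0 < 4 * (z i).toNat; omega,
      ⟨2 * (z i).toNat, by change 4 * (z i).toNat = _; omega⟩⟩
  · intro i j
    rw [Module.Basis.unitsSMul_apply, Module.Basis.unitsSMul_apply]
    simp only [Units.smul_mk0, map_smul, LinearMap.smul_apply, smul_eq_mul]
    split_ifs with hij
    · subst hij
      have h1 := hz i
      simp only [map_smul, LinearMap.smul_apply, smul_eq_mul] at h1
      push_cast
      rw [hzn]
      have hzz := (hzq i).ne'
      simp only [a]
      field_simp
      linear_combination 4 * h1
    · rw [hv i j hij]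
      simp
  · intro i
    refine ⟨_, hnv i, ?_⟩
    rw [Module.Basis.unitsSMul_apply]
    simp only [Units.smul_mk0, smul_smul]
    congr 1
    push_cast
    rw [hzn]
    have hzz := (hzq i).ne'
    simp only [a]
    field_simp
    ring

lemma vdb_coord (c : Module.Basis (Fin h) ℚ (Fin h → ℚ)) (d : Fin h → ℕ)
    (hd : ∀ i, 0 < d i ∧ Even (d i))
    (hc : ∀ i j, β (c i) (c j) = if i = j then 1 / (d i : ℚ) else 0)
    (x : Fin h → ℚ) (hx : ∀ i, vdbInt (β x ((d i : ℚ) • c i))) :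
    ∃ m : Fin h → ℤ, x = ∑ i, (m i : ℚ) • c i := by
  choose m hm using hx
  refine ⟨m, ?_⟩
  conv_lhs => rw [← c.sum_repr x]
  refine Finset.sum_congr rfl fun i _ => ?_
  congr 1
  rw [← hm i]
  have hdi : (d i : ℚ) ≠ 0 := by exact_mod_cast (hd i).1.ne'
  conv_rhs => rw [← c.sum_repr x]
  rw [map_smul, map_sum, LinearMap.sum_apply]
  simp only [map_smul, LinearMap.smul_apply, hc, smul_eq_mul]
  simp
  field_simp

lemma vdb_char (hsymm : ∀ x y, β x y = β y x) (hpos : ∀ x, x ≠ 0 → 0 < β x x)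
    (hL : IsUnimodularLattice β L) :
    ∃ w ∈ L, ∀ x ∈ L, ∃ n : ℤ, β w x = β x x + 2 * n := by
  obtain ⟨c, d, hd, hc, hy⟩ := vdb_basis β L hsymm hpos hL
  have hle : L ≤ Submodule.span ℤ (Set.range c) := by
    intro x hx
    obtain ⟨m, rfl⟩ := vdb_coord β c d hd hc x (fun i => by
      obtain ⟨y, hyL, hy⟩ := hy i
      rw [hy, map_smul, smul_eq_mul]
      exact (vdbInt.int 2).mul (vdb_int_of_mem β L hL hx hyL))
    refine Submodule.sum_mem _ fun i _ => ?_
    rw [Int.cast_smul_eq_zsmul]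
    exact Submodule.smul_mem _ _ (Submodule.subset_span ⟨i, rfl⟩)
  have hfg : L.FG := (Submodule.fg_span (Set.finite_range c)).of_le hle
  have : Module.Finite ℤ L := Module.Finite.iff_fg.2 hfg
  let b := Module.Free.chooseBasis ℤ L
  have hli : LinearIndependent ℤ (fun j => ((b j : L) : Fin h → ℚ)) :=
    b.linearIndependent.map' L.subtype (Submodule.ker_subtype L)
  rw [LinearIndependent.iff_fractionRing ℤ ℚ] at hli
  let s := Module.Basis.span hli
  obtain ⟨f, hf⟩ := LinearMap.exists_extend
    (s.constr ℚ (fun j => β (b j : Fin h → ℚ) (b j : Fin h → ℚ)))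
  have hfb : ∀ j, f (b j : Fin h → ℚ) = β (b j : Fin h → ℚ) (b j : Fin h → ℚ) := by
    intro j
    have h1 := LinearMap.congr_fun hf (s j)
    rw [Module.Basis.constr_basis] at h1
    rw [← h1]
    simp [s, Module.Basis.span_apply]
  let B : LinearMap.BilinForm ℚ (Fin h → ℚ) := β
  have hB : B.Nondegenerate := by
    constructor
    · intro x hx
      by_contra hne
      exact (hpos x hne).ne' (hx x)
    · intro x hx
      by_contra hne
      exact (hpos x hne).ne' (hx x)
  let w := (B.toDual hB).symm f
  have hw : ∀ x, β w x = f x := fun x => B.apply_toDual_symm_apply f x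
  have key : ∀ x ∈ L, ∃ n : ℤ, β w x = β x x + 2 * n := by
    let K : Submodule ℤ (Fin h → ℚ) :=
      { carrier := {x | x ∈ L ∧ ∃ n : ℤ, β w x = β x x + 2 * n}
        zero_mem' := ⟨L.zero_mem, 0, by simp⟩
        add_mem' := by
          rintro x y ⟨hx, n, hn⟩ ⟨hy, m, hm⟩
          refine ⟨L.add_mem hx hy, ?_⟩
          obtain ⟨k, hk⟩ := vdb_int_of_mem β L hL hx hy
          refine ⟨n + m - k, ?_⟩
          simp only [map_add, LinearMap.add_apply]
          rw [hn, hm, hsymm y x, hk]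
          push_cast
          ring
        smul_mem' := by
          rintro z x ⟨hx, n, hn⟩
          refine ⟨L.smul_mem z hx, ?_⟩
          obtain ⟨k, hk⟩ := vdb_int_of_mem β L hL hx hx
          obtain ⟨t, ht⟩ := Int.even_mul_pred_self z
          refine ⟨z * n - t * k, ?_⟩
          simp only [← Int.cast_smul_eq_zsmul ℚ, map_smul, LinearMap.smul_apply, smul_eq_mul]
          rw [hn, hk]
          have ht' : (z : ℚ) * (z - 1) = t + t := by exact_mod_cast ht
          push_cast
          linear_combination (-(k : ℚ)) * ht' }
    intro x hx
    suffices x ∈ K from this.2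
    have h1 : x = ∑ j, b.repr ⟨x, hx⟩ j • (b j : Fin h → ℚ) := by
      calc x = L.subtype (∑ j, b.repr ⟨x, hx⟩ j • b j) := by rw [b.sum_repr]; rfl
        _ = _ := by rw [map_sum]; rfl
    rw [h1]
    refine K.sum_mem fun j _ => K.smul_mem _ ⟨(b j).2, 0, ?_⟩
    rw [hw, hfb]
    simp
  refine ⟨w, ?_, key⟩
  rw [hL]
  intro x hx
  obtain ⟨n, hn⟩ := key x hx
  rw [hn]
  exact (vdb_int_of_mem β L hL hx hx).add ((vdbInt.int 2).mul (vdbInt.int n))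

end lattice

/-- `exp (π i q)` for rational `q`. -/
noncomputable def vdbEx (q : ℚ) : ℂ := Complex.exp (Real.pi * Complex.I * (q : ℂ))

lemma vdbEx_add (p q : ℚ) : vdbEx (p + q) = vdbEx p * vdbEx q := by
  rw [vdbEx, vdbEx, vdbEx, ← Complex.exp_add]
  congr 1
  push_cast
  ring

lemma vdbEx_zero : vdbEx 0 = 1 := by simp [vdbEx]

lemma vdbEx_one : vdbEx 1 = -1 := by simp [vdbEx]

lemma vdbEx_ne_zero (q : ℚ) : vdbEx q ≠ 0 := Complex.exp_ne_zero _

lemma vdbEx_norm (q : ℚ) : ‖vdbEx q‖ = 1 := by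
  have : (Real.pi * Complex.I * (q : ℂ)) = ((Real.pi * q : ℝ) : ℂ) * Complex.I := by
    push_cast
    ring
  rw [vdbEx, this, Complex.norm_exp_ofReal_mul_I]

lemma vdbEx_eq_one_iff (q : ℚ) : vdbEx q = 1 ↔ ∃ n : ℤ, q = 2 * n := by
  rw [vdbEx, Complex.exp_eq_one_iff]
  have hpi : (Real.pi : ℂ) ≠ 0 := by exact_mod_cast Real.pi_ne_zero
  constructor
  · rintro ⟨n, hn⟩
    refine ⟨n, ?_⟩
    have h1 : (Real.pi * Complex.I : ℂ) * (q : ℂ) = (Real.pi * Complex.I) * (2 * n) := by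
      rw [hn]; ring
    have h2 := mul_left_cancel₀ (mul_ne_zero hpi Complex.I_ne_zero) h1
    exact_mod_cast h2
  · rintro ⟨n, rfl⟩
    refine ⟨n, ?_⟩
    push_cast
    ring

lemma vdbEx_sum {ι : Type*} (s : Finset ι) (f : ι → ℚ) :
    vdbEx (∑ i ∈ s, f i) = ∏ i ∈ s, vdbEx (f i) := by
  classical
  induction s using Finset.induction_on with
  | empty => simp [vdbEx_zero]
  | insert a s ha ih => rw [Finset.sum_insert ha, Finset.prod_insert ha, vdbEx_add, ih]

/-- The lemma of van der Blij in the form of an identity of Gauss sums. -/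
lemma vdb_identity {h : ℕ} (β : (Fin h → ℚ) →ₗ[ℚ] (Fin h → ℚ) →ₗ[ℚ] ℚ)
    (L : Submodule ℤ (Fin h → ℚ)) (hsymm : ∀ x y, β x y = β y x)
    (hpos : ∀ x, x ≠ 0 → 0 < β x x)
    (hL : IsUnimodularLattice β L) (w : Fin h → ℚ) (hw : w ∈ L)
    (hchar : ∀ x ∈ L, ∃ n : ℤ, β w x = β x x + 2 * n) :
    ∃ r : ℝ, 0 < r ∧ vdbEx (β w w / 4) = r * Complex.exp (Real.pi * Complex.I / 4) ^ h := by
  classical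
  obtain ⟨c, d, hd, hc, hy⟩ := vdb_basis β L hsymm hpos hL
  have : ∀ i, NeZero (d i) := fun i => ⟨(hd i).1.ne'⟩
  have hdq : ∀ i, (d i : ℚ) ≠ 0 := fun i => by exact_mod_cast (hd i).1.ne'
  choose y hyL hyc using hy
  choose d2 hd2 using fun i => (hd i).2
  have hd2q : ∀ i, (d i : ℚ) = 2 * d2 i := fun i => by
    have := hd2 i
    rw [this]
    push_cast
    ring
  let φ : (Fin h → ℤ) → (Fin h → ℚ) := fun k => ∑ i, (k i : ℚ) • c i
  have hφadd : ∀ k l : Fin h → ℤ, φ (fun i => k i + l i) = φ k + φ l := by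
    intro k l
    simp only [φ]
    rw [← Finset.sum_add_distrib]
    refine Finset.sum_congr rfl fun i _ => ?_
    push_cast
    rw [add_smul]
  have hφβ : ∀ k l : Fin h → ℤ, β (φ k) (φ l) = ∑ i, (k i : ℚ) * l i / d i := by
    intro k l
    simp only [φ, map_sum, LinearMap.sum_apply, map_smul, LinearMap.smul_apply, hc, smul_eq_mul]
    refine Finset.sum_congr rfl fun i _ => ?_
    simp
    ring
  -- period vectors
  have hp_L : ∀ t : Fin h → ℤ, φ (fun i => d i * t i) ∈ L := by
    intro t
    refine Submodule.sum_mem _ fun i _ => ?_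
    have : (((d i : ℤ) * t i : ℤ) : ℚ) • c i = ((t i * 2 : ℤ) : ℚ) • y i := by
      push_cast
      rw [mul_comm, ← smul_smul, hyc, smul_smul]
    rw [this]
    exact vdb_smul_mem L (hyL i)
  have hp_int : ∀ k t : Fin h → ℤ, vdbInt (β (φ k) (φ (fun i => d i * t i))) := by
    intro k t
    rw [hφβ]
    refine vdbInt.sum _ _ fun i _ => ⟨k i * t i, ?_⟩
    have := hdq i
    push_cast
    field_simp
  have hp_even : ∀ t : Fin h → ℤ, ∃ n : ℤ,
      β (φ (fun i => d i * t i)) (φ (fun i => d i * t i)) = 2 * n := by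
    intro t
    refine ⟨∑ i, d2 i * t i ^ 2, ?_⟩
    rw [hφβ]
    push_cast
    rw [Finset.mul_sum]
    refine Finset.sum_congr rfl fun i _ => ?_
    have := hdq i
    field_simp
    rw [hd2q]
    ring
  have hLcoord : ∀ x, (∀ i, vdbInt (β x ((2 : ℚ) • y i))) → ∃ m : Fin h → ℤ, x = φ m := by
    intro x hx
    exact vdb_coord β c d hd hc x (fun i => by rw [hyc]; exact hx i)
  obtain ⟨μ, hμ⟩ := hLcoord ((1 / 2 : ℚ) • w) (fun i => by
    have : β ((1 / 2 : ℚ) • w) ((2 : ℚ) • y i) = β w (y i) := by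
      simp only [map_smul, LinearMap.smul_apply, smul_eq_mul]
      ring
    rw [this]
    exact vdb_int_of_mem β L hL hw (hyL i))
  have hwμ : w = (2 : ℚ) • φ μ := by rw [← hμ, smul_smul]; norm_num
  let F1 : (Fin h → ℤ) → ℂ := fun k => vdbEx (β (φ k) (φ k))
  have hF1 : ∀ k t : Fin h → ℤ, F1 (fun i => k i + d i * t i) = F1 k := by
    intro k t
    simp only [F1]
    rw [hφadd k (fun i => d i * t i)]
    obtain ⟨a, ha⟩ := hp_int k t
    obtain ⟨b, hb⟩ := hp_even t
    simp only [map_add, LinearMap.add_apply]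
    rw [hb, hsymm (φ (fun i => d i * t i)) (φ k), ha]
    have : β (φ k) (φ k) + (a : ℚ) + (a + 2 * b) = β (φ k) (φ k) + 2 * ((a + b : ℤ) : ℚ) := by
      push_cast; ring
    have h2 : vdbEx (2 * ((a + b : ℤ) : ℚ)) = 1 := (vdbEx_eq_one_iff _).2 ⟨_, rfl⟩
    have h3 : β (φ k) (φ k) + (a : ℚ) + ((a : ℚ) + 2 * b) = β (φ k) (φ k) + 2 * ((a + b : ℤ) : ℚ) := by
      push_cast; ring
    rw [h3, vdbEx_add, h2, mul_one]
  let v : (∀ i, ZMod (d i)) → (Fin h → ℤ) := fun k i => ((k i).val : ℤ)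
  let G : (Fin h → ℤ) → ℂ := fun k => vdbEx (β (φ k) (φ k) + β (φ k) w)
  have hGF : ∀ k : Fin h → ℤ, F1 (fun i => k i + μ i) = vdbEx (β w w / 4) * G k := by
    intro k
    simp only [F1, G]
    rw [hφadd, ← vdbEx_add, hwμ]
    congr 1
    simp only [map_add, LinearMap.add_apply, map_smul, LinearMap.smul_apply, smul_eq_mul]
    rw [hsymm (φ μ) (φ k)]
    ring
  have hG : ∀ k t : Fin h → ℤ, G (fun i => k i + d i * t i) = G k := by
    intro k t
    have h1 := hGF (fun i => k i + d i * t i)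
    have h2 := hF1 (fun i => k i + μ i) t
    have h3 : (fun i => k i + d i * t i + μ i) = (fun i => k i + μ i + d i * t i) := by
      funext i; ring
    rw [h3, h2, hGF k] at h1
    exact (mul_left_cancel₀ (vdbEx_ne_zero _) h1).symm
  have hS : ∑ k, F1 (v k) = vdbEx (β w w / 4) * ∑ k, G (v k) := by
    rw [← vdb_box_shift d F1 hF1 μ, Finset.mul_sum]
    exact Finset.sum_congr rfl fun k _ => hGF (v k)
  -- the product formula
  obtain ⟨r, hr, hrS⟩ : ∃ r : ℝ, 0 < r ∧
      ∑ k, F1 (v k) = r * Complex.exp (Real.pi * Complex.I / 4) ^ h := by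
    choose r hr hrg using fun i => vdb_gauss (d i) (hd i).2
    refine ⟨∏ i, r i, Finset.prod_pos fun i _ => hr i, ?_⟩
    have h1 : ∀ k : (∀ i, ZMod (d i)), F1 (v k)
        = ∏ i, Complex.exp (Real.pi * Complex.I * (((k i).val : ℤ) : ℂ) ^ 2 / d i) := by
      intro k
      simp only [F1]
      rw [hφβ, vdbEx_sum]
      refine Finset.prod_congr rfl fun i _ => ?_
      rw [vdbEx]
      congr 1
      simp only [v]
      push_cast
      ring
    rw [Finset.sum_congr rfl fun k _ => h1 k]
    have h2 := Finset.prod_univ_sum (fun i => (Finset.univ : Finset (ZMod (d i))))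
      (fun i x => Complex.exp (Real.pi * Complex.I * ((x.val : ℤ) : ℂ) ^ 2 / d i))
    rw [Fintype.piFinset_univ] at h2
    rw [← h2, Finset.prod_congr rfl fun i _ => hrg i, Finset.prod_mul_distrib]
    simp
  -- the character sums
  let F3 : (Fin h → ℤ) → (Fin h → ℤ) → ℂ := fun l k =>
    if φ k ∈ L then vdbEx (2 * β (φ l) (φ k)) else 0
  have hF3 : ∀ l k t : Fin h → ℤ, F3 l (fun i => k i + d i * t i) = F3 l k := by
    intro l k t
    simp only [F3]
    rw [hφadd k (fun i => d i * t i), Submodule.add_mem_iff_left _ (hp_L t)]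
    obtain ⟨a, ha⟩ := hp_int l t
    rw [map_add, ha, mul_add, vdbEx_add, (vdbEx_eq_one_iff (2 * (a : ℚ))).2 ⟨a, rfl⟩, mul_one]
  let T : (Fin h → ℤ) → ℂ := fun l => ∑ k, F3 l (v k)
  have hTL : ∀ l, φ l ∈ L → T l = T 0 := by
    intro l hl
    refine Finset.sum_congr rfl fun k _ => ?_
    simp only [F3]
    split_ifs with hk
    · obtain ⟨a, ha⟩ := vdb_int_of_mem β L hL hl hk
      have h0 : φ 0 = 0 := by simp [φ]
      rw [ha, h0, (vdbEx_eq_one_iff (2 * (a : ℚ))).2 ⟨a, rfl⟩]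
      simp [vdbEx_zero]
    · rfl
  have hTn : ∀ l, φ l ∉ L → T l = 0 := by
    intro l hl
    rw [hL] at hl
    push Not at hl
    obtain ⟨x, hx, hxn⟩ := hl
    obtain ⟨m, rfl⟩ := hLcoord x (fun i => by
      rw [map_smul, smul_eq_mul]
      exact (vdbInt.int 2).mul (vdb_int_of_mem β L hL hx (hyL i)))
    have h1 := vdb_box_shift d (F3 l) (hF3 l) m
    have h2 : ∀ k : Fin h → ℤ, F3 l (fun i => k i + m i)
        = vdbEx (2 * β (φ l) (φ m)) * F3 l k := by
      intro k
      simp only [F3]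
      rw [hφadd, Submodule.add_mem_iff_left _ hx, map_add, mul_add, vdbEx_add]
      split_ifs
      · ring
      · simp
    have h3 : vdbEx (2 * β (φ l) (φ m)) * T l = T l := by
      simp only [T]
      rw [Finset.mul_sum]
      exact (Finset.sum_congr rfl fun k _ => (h2 (v k)).symm).trans h1
    by_contra hne
    have h4 : vdbEx (2 * β (φ l) (φ m)) = 1 :=
      mul_right_cancel₀ hne (by rw [h3, one_mul])
    obtain ⟨n, hn⟩ := (vdbEx_eq_one_iff _).1 h4
    exact hxn n (by linarith)
  obtain ⟨N, hN, hT0⟩ : ∃ N : ℝ, 0 < N ∧ T 0 = N := by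
    refine ⟨((Finset.univ.filter fun k => φ (v k) ∈ L).card : ℝ), ?_, ?_⟩
    · have : (0 : ∀ i, ZMod (d i)) ∈ Finset.univ.filter fun k => φ (v k) ∈ L := by
        simp [φ, v]
      exact_mod_cast Finset.card_pos.2 ⟨_, this⟩
    · have h0 : φ 0 = 0 := by simp [φ]
      simp only [T, F3, h0]
      simp [vdbEx_zero, Finset.sum_ite]
  have hG1 : ∀ k, φ k ∈ L → G k = 1 := by
    intro k hk
    simp only [G]
    obtain ⟨n, hn⟩ := hchar _ hk
    obtain ⟨a, ha⟩ := vdb_int_of_mem β L hL hk hk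
    rw [hsymm (φ k) w, hn, ha]
    exact (vdbEx_eq_one_iff _).2 ⟨a + n, by push_cast; ring⟩
  have hGshift : ∀ m, φ m ∈ L → ∑ k, G (v k) = ∑ k, G (v k) * vdbEx (2 * β (φ (v k)) (φ m)) := by
    intro m hm
    rw [← vdb_box_shift d G hG m]
    refine Finset.sum_congr rfl fun k _ => ?_
    have h1 := hG1 m hm
    change G (fun i => v k i + m i) = _
    simp only [G] at h1 ⊢
    rw [hφadd]
    have : β (φ (v k) + φ m) (φ (v k) + φ m) + β (φ (v k) + φ m) w
        = β (φ (v k)) (φ (v k)) + β (φ (v k)) w + 2 * β (φ (v k)) (φ m)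
          + (β (φ m) (φ m) + β (φ m) w) := by
      simp only [map_add, LinearMap.add_apply]
      rw [hsymm (φ m) (φ (v k))]
      ring
    rw [this, vdbEx_add, h1, mul_one, vdbEx_add]
  have hmain : T 0 * ∑ k, G (v k) = T 0 * T 0 := by
    have h0 : φ 0 = 0 := by simp [φ]
    calc T 0 * ∑ k, G (v k) = ∑ m, ∑ k, G (v k) * F3 (v k) (v m) := by
          simp only [T]
          rw [Finset.sum_mul]
          refine Finset.sum_congr rfl fun m _ => ?_
          simp only [F3, h0]
          split_ifs with hm
          · simp only [map_zero, LinearMap.zero_apply, mul_zero, vdbEx_zero, one_mul]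
            exact hGshift _ hm
          · simp
      _ = ∑ k, G (v k) * T (v k) := by
          rw [Finset.sum_comm]
          refine Finset.sum_congr rfl fun k _ => ?_
          rw [Finset.mul_sum]
      _ = ∑ k, T 0 * F3 0 (v k) := by
          refine Finset.sum_congr rfl fun k _ => ?_
          by_cases hk : φ (v k) ∈ L
          · rw [hTL _ hk, hG1 _ hk]
            simp only [F3, h0, if_pos hk]
            simp [vdbEx_zero]
          · rw [hTn _ hk]
            simp only [F3, if_neg hk]
            simp
      _ = T 0 * T 0 := by rw [← Finset.mul_sum]
  have hNc : (N : ℂ) ≠ 0 := by exact_mod_cast hN.ne'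
  rw [hT0] at hmain
  have hGN : ∑ k, G (v k) = N := mul_left_cancel₀ hNc hmain
  rw [hGN, hrS] at hS
  refine ⟨r / N, by positivity, ?_⟩
  push_cast
  field_simp
  rw [← hS]

lemma vdb_four {h : ℕ} (h4 : h % 8 = 4) (β : (Fin h → ℚ) →ₗ[ℚ] (Fin h → ℚ) →ₗ[ℚ] ℚ)
    (L : Submodule ℤ (Fin h → ℚ)) (hsymm : ∀ x y, β x y = β y x)
    (hpos : ∀ x, x ≠ 0 → 0 < β x x)
    (hL : IsUnimodularLattice β L) (w : Fin h → ℚ) (hw : w ∈ L)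
    (hchar : ∀ x ∈ L, ∃ n : ℤ, β w x = β x x + 2 * n) :
    ∃ n : ℤ, β w w = 4 * (2 * n + 1) := by
  obtain ⟨r, hr, hre⟩ := vdb_identity β L hsymm hpos hL w hw hchar
  have hp : Complex.exp (Real.pi * Complex.I / 4) ^ h = -1 := by
    obtain ⟨q, hq⟩ : ∃ q, h = 4 * (2 * q + 1) := ⟨h / 8, by omega⟩
    rw [hq, pow_mul, ← Complex.exp_nat_mul]
    have : ((4 : ℕ) : ℂ) * (Real.pi * Complex.I / 4) = Real.pi * Complex.I := by push_cast; ring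
    rw [this, Complex.exp_pi_mul_I, Odd.neg_one_pow ⟨q, rfl⟩]
  rw [hp] at hre
  have hn := congrArg norm hre
  rw [vdbEx_norm, norm_mul, norm_neg, norm_one, mul_one, Complex.norm_real, Real.norm_eq_abs,
    abs_of_pos hr] at hn
  rw [← hn] at hre
  have h1 : vdbEx (β w w / 4 + 1) = 1 := by
    rw [vdbEx_add, hre, vdbEx_one]
    simp
  obtain ⟨n, hn⟩ := (vdbEx_eq_one_iff _).1 h1
  refine ⟨n - 1, ?_⟩
  push_cast
  linarith

section neighbours

variable {h : ℕ} (β : (Fin h → ℚ) →ₗ[ℚ] (Fin h → ℚ) →ₗ[ℚ] ℚ)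
    (L : Submodule ℤ (Fin h → ℚ))

/-- `q` is an even integer. -/
def vdbEven (q : ℚ) : Prop := ∃ n : ℤ, Even n ∧ q = (n : ℚ)

lemma vdbEven_iff (q : ℚ) : vdbEven q ↔ ∃ n : ℤ, q = 2 * n := by
  constructor
  · rintro ⟨n, ⟨m, rfl⟩, rfl⟩
    exact ⟨m, by push_cast; ring⟩
  · rintro ⟨n, rfl⟩
    exact ⟨2 * n, even_two_mul n, by push_cast; ring⟩

lemma vdbEven_not_odd (n : ℤ) : ¬ vdbEven (2 * n + 1) := by
  rw [vdbEven_iff]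
  rintro ⟨m, hm⟩
  have : 2 * n + 1 = 2 * m := by exact_mod_cast hm
  omega

/-- The even sublattice as a submodule. -/
def vdbM (hsymm : ∀ x y, β x y = β y x) (hL : IsUnimodularLattice β L) :
    Submodule ℤ (Fin h → ℚ) where
  carrier := M2set β L
  zero_mem' := ⟨L.zero_mem, 0, by simp⟩
  add_mem' := by
    rintro x y ⟨hx, n, ⟨n', hn'⟩, hn⟩ ⟨hy, m, ⟨m', hm'⟩, hm⟩
    obtain ⟨k, hk⟩ := vdb_int_of_mem β L hL hx hy
    refine ⟨L.add_mem hx hy, n + m + 2 * k, ⟨n' + m' + k, by omega⟩, ?_⟩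
    simp only [map_add, LinearMap.add_apply]
    rw [hn, hm, hsymm y x, hk]
    push_cast
    ring
  smul_mem' := by
    rintro z x ⟨hx, n, hn', hn⟩
    refine ⟨L.smul_mem z hx, z * (z * n), (hn'.mul_left _).mul_left _, ?_⟩
    simp only [← Int.cast_smul_eq_zsmul ℚ, map_smul, LinearMap.smul_apply, smul_eq_mul]
    rw [hn]
    push_cast
    ring

end neighbours

/-- an odd unimodular integral lattice of rank `h ≡ 4 mod 8` has exactly
two neighbours sharing the index-two sublattice `M₂(L)`, and both are odd. -/
theorem stmt16 (h : ℕ) (hh : 1 ≤ h) (h4 : h % 8 = 4)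
    (β : (Fin h → ℚ) →ₗ[ℚ] (Fin h → ℚ) →ₗ[ℚ] ℚ)
    (hsymm : ∀ x y, β x y = β y x)
    (hpos : ∀ x, x ≠ 0 → 0 < β x x)
    (L : Submodule ℤ (Fin h → ℚ))
    (hL : IsUnimodularLattice β L) (hodd : IsOddLattice β L) :
    (∃ N₁ N₂ : Submodule ℤ (Fin h → ℚ), N₁ ≠ N₂ ∧
      {N : Submodule ℤ (Fin h → ℚ) | IsUnimodularLattice β N ∧
          ((N ⊓ L : Submodule ℤ (Fin h → ℚ)) : Set (Fin h → ℚ)) = M2set β L}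
        = {N₁, N₂}) ∧
    (∀ N : Submodule ℤ (Fin h → ℚ), IsUnimodularLattice β N →
      ((N ⊓ L : Submodule ℤ (Fin h → ℚ)) : Set (Fin h → ℚ)) = M2set β L →
      IsOddLattice β N) := by
  obtain ⟨w, hw, hchar⟩ := vdb_char β L hsymm hpos hL
  obtain ⟨q, hq⟩ := vdb_four h4 β L hsymm hpos hL w hw hchar
  obtain ⟨e, he, oe, ⟨e', he'⟩, hoe⟩ := hodd
  have hee : β e e = 2 * e' + 1 := by rw [hoe, he']; push_cast; ring
  have hbInt : ∀ {x y : Fin h → ℚ}, x ∈ L → y ∈ L → vdbInt (β x y) :=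
    fun hx hy => vdb_int_of_mem β L hL hx hy
  let M := vdbM β L hsymm hL
  have hM : ∀ x, x ∈ M ↔ x ∈ L ∧ vdbEven (β x x) := fun x => Iff.rfl
  have hML : ∀ x ∈ M, x ∈ L := fun x hx => hx.1
  have hMset : (M : Set (Fin h → ℚ)) = M2set β L := rfl
  -- dichotomy
  have hdich : ∀ x ∈ L, x ∈ M ∨ x - e ∈ M := by
    intro x hx
    obtain ⟨n, hn⟩ := hbInt hx hx
    rcases Int.even_or_odd n with hev | ⟨m, hm⟩
    · exact Or.inl ⟨hx, n, hev, hn⟩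
    · right
      refine ⟨L.sub_mem hx he, ?_⟩
      obtain ⟨k, hk⟩ := hbInt hx he
      change vdbEven _
      rw [vdbEven_iff]
      refine ⟨m + e' + 1 - k, ?_⟩
      simp only [map_sub, LinearMap.sub_apply]
      rw [hn, hm, hsymm e x, hk, hee]
      push_cast
      ring
  have heM : e ∉ M := fun hh => vdbEven_not_odd e' (hee ▸ hh.2)
  have h2eM : (2 : ℤ) • e ∈ M := by
    refine ⟨L.smul_mem 2 he, ?_⟩
    change vdbEven _
    rw [vdbEven_iff]
    refine ⟨2 * (2 * e' + 1), ?_⟩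
    simp only [← Int.cast_smul_eq_zsmul ℚ, map_smul, LinearMap.smul_apply, smul_eq_mul, hee]
    push_cast
    ring
  -- half of the characteristic vector
  let u : Fin h → ℚ := (1 / 2 : ℚ) • w
  have hux : ∀ x, β u x = β w x / 2 := by
    intro x
    simp only [u, map_smul, LinearMap.smul_apply, smul_eq_mul]
    ring
  have huu : β u u = 2 * q + 1 := by
    rw [hux, hsymm, hux, hq]
    ring
  have huM : ∀ x ∈ M, vdbInt (β u x) := by
    intro x hx
    obtain ⟨n, hn⟩ := hchar x hx.1
    obtain ⟨m, hm⟩ := (vdbEven_iff _).1 hx.2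
    exact ⟨m + n, by rw [hux, hn, hm]; push_cast; ring⟩
  have hueven : ∀ x ∈ L, vdbInt (β u x) → x ∈ M := by
    intro x hx ⟨k, hk⟩
    obtain ⟨n, hn⟩ := hchar x hx
    refine ⟨hx, (vdbEven_iff _).2 ⟨k - n, ?_⟩⟩
    rw [hux] at hk
    push_cast
    linarith
  have hue : ∃ k : ℤ, β u e = k + 1 / 2 := by
    obtain ⟨n, hn⟩ := hchar e he
    exact ⟨e' + n, by rw [hux, hn, hee]; push_cast; ring⟩
  have huL : u ∉ L := fun hh => heM (hueven e he (hbInt hh he))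
  have h2uM : (2 : ℤ) • u ∈ M := by
    have h1 : (2 : ℤ) • u = w := by
      rw [← Int.cast_smul_eq_zsmul ℚ]
      simp only [u, smul_smul]
      norm_num
    rw [h1]
    refine ⟨hw, (vdbEven_iff _).2 ⟨2 * (2 * q + 1), ?_⟩⟩
    rw [hq]
    push_cast
    ring
  -- the dual of `M`
  have hdualM : ∀ x, (∀ y ∈ M, vdbInt (β x y)) → x ∈ L ∨ x - u ∈ L := by
    intro x hx
    have hLof : ∀ z : Fin h → ℚ, (∀ y ∈ M, vdbInt (β z y)) → vdbInt (β z e) → z ∈ L := by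
      intro z hz hze
      rw [hL]
      intro y hy
      rcases hdich y hy with h1 | h1
      · exact hz y h1
      · have := (hz _ h1).add hze
        rw [map_sub, sub_add_cancel] at this
        exact this
    obtain ⟨n, hn⟩ := hx _ h2eM
    simp only [← Int.cast_smul_eq_zsmul ℚ, map_smul, smul_eq_mul] at hn
    push_cast at hn
    rcases Int.even_or_odd n with ⟨m, hm⟩ | ⟨m, hm⟩
    · left
      refine hLof x hx ⟨m, ?_⟩
      rw [hm] at hn
      push_cast at hn
      linarith
    · right
      refine hLof _ (fun y hy => ?_) ?_
      · rw [map_sub, LinearMap.sub_apply]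
        exact (hx y hy).sub (huM y hy)
      · obtain ⟨k, hk⟩ := hue
        refine ⟨m - k, ?_⟩
        rw [map_sub, LinearMap.sub_apply, hk]
        rw [hm] at hn
        push_cast at hn ⊢
        linarith
  -- glue vectors
  let Good : (Fin h → ℚ) → Prop := fun v => v - u ∈ L ∧ (2 : ℤ) • v ∈ M ∧
    (∃ n : ℤ, β v v = 2 * n + 1)
  have hGu : Good u := ⟨by simp, h2uM, q, huu⟩
  have hGue : Good (u + e) := by
    refine ⟨by simpa using he, by rw [smul_add]; exact M.add_mem h2uM h2eM, ?_⟩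
    obtain ⟨k, hk⟩ := hue
    refine ⟨q + k + e' + 1, ?_⟩
    simp only [map_add, LinearMap.add_apply]
    rw [huu, hsymm e u, hk, hee]
    push_cast
    ring
  let N : (Fin h → ℚ) → Submodule ℤ (Fin h → ℚ) := fun v => M ⊔ Submodule.span ℤ {v}
  have hN : ∀ v x, x ∈ N v ↔ ∃ y ∈ M, ∃ k : ℤ, x = y + k • v := by
    intro v x
    simp only [N, Submodule.mem_sup, Submodule.mem_span_singleton]
    constructor
    · rintro ⟨y, hy, z, ⟨k, rfl⟩, rfl⟩
      exact ⟨y, hy, k, rfl⟩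
    · rintro ⟨y, hy, k, rfl⟩
      exact ⟨y, hy, _, ⟨k, rfl⟩, rfl⟩
  have hMN : ∀ v, M ≤ N v := fun v => le_sup_left
  have hvN : ∀ v, v ∈ N v := fun v => (hN v v).2 ⟨0, M.zero_mem, 1, by simp⟩
  have hvM : ∀ v, Good v → ∀ y ∈ M, vdbInt (β v y) := by
    intro v hv y hy
    have h1 := (hbInt hv.1 (hML y hy)).add (huM y hy)
    rw [map_sub, LinearMap.sub_apply, sub_add_cancel] at h1
    exact h1
  have hvL : ∀ v, Good v → v ∉ L := by
    intro v hv hh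
    apply huL
    have := L.sub_mem hh hv.1
    rwa [sub_sub_cancel] at this
  have hNL : ∀ v, Good v → ∀ x, x ∈ N v → x ∈ L → x ∈ M := by
    intro v hv x hx hxL
    obtain ⟨y, hy, k, rfl⟩ := (hN v x).1 hx
    rcases Int.even_or_odd k with ⟨m, hm⟩ | ⟨m, hm⟩
    · refine M.add_mem hy ?_
      have : k • v = m • ((2 : ℤ) • v) := by rw [smul_smul, hm]; congr 1; ring
      rw [this]
      exact M.smul_mem _ hv.2.1
    · exfalso
      apply hvL v hv
      have h1 : v = (y + k • v) - y - m • ((2 : ℤ) • v) := by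
        rw [smul_smul, hm, add_sub_cancel_left, ← sub_smul]
        have : 2 * m + 1 - m * 2 = 1 := by ring
        rw [this, one_smul]
      rw [h1]
      exact L.sub_mem (L.sub_mem hxL (hML y hy)) (L.smul_mem m (hML _ hv.2.1))
  have hNint : ∀ v, Good v → ∀ x ∈ N v, ∀ y ∈ N v, vdbInt (β x y) := by
    intro v hv x hx y hy
    obtain ⟨x', hx', k, rfl⟩ := (hN v x).1 hx
    obtain ⟨y', hy', l, rfl⟩ := (hN v y).1 hy
    obtain ⟨n, hn⟩ := hv.2.2
    have h1 : vdbInt (β v v) := ⟨2 * n + 1, by rw [hn]; push_cast; ring⟩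
    have h2 := hvM v hv x' hx'
    rw [hsymm] at h2
    simp only [← Int.cast_smul_eq_zsmul ℚ, map_add, map_smul, LinearMap.add_apply,
      LinearMap.smul_apply, smul_eq_mul]
    have := hbInt (hML _ hx') (hML _ hy')
    have := hvM v hv y' hy'
    exact vdbInt.add (vdbInt.add ‹_› ((vdbInt.int _).mul ‹_›))
      ((vdbInt.int _).mul (vdbInt.add ‹_› ((vdbInt.int _).mul ‹_›)))
  have hNuni : ∀ v, Good v → IsUnimodularLattice β (N v) := by
    intro v hv x
    refine ⟨fun hx y hy => hNint v hv x hx y hy, fun hx => ?_⟩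
    have hLcase : ∀ z, z ∈ L → (∀ y ∈ N v, vdbInt (β z y)) → z ∈ M := by
      intro z hz hzN
      apply hueven z hz
      have h1 := (hzN v (hvN v)).sub (hbInt hz hv.1)
      rw [map_sub, sub_sub_cancel, hsymm] at h1
      exact h1
    rcases hdualM x (fun y hy => hx y (hMN v hy)) with h1 | h1
    · exact hMN v (hLcase x h1 hx)
    · have h2 : x - v ∈ L := by
        have := L.sub_mem h1 hv.1
        rwa [sub_sub_sub_cancel_right] at this
      have h3 := hLcase (x - v) h2 (fun y hy => by
        rw [map_sub, LinearMap.sub_apply]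
        exact vdbInt.sub (hx y hy) (hNint v hv v (hvN v) y hy))
      have := (N v).add_mem (hMN v h3) (hvN v)
      rwa [sub_add_cancel] at this
  have hNinf : ∀ v, Good v → (((N v) ⊓ L : Submodule ℤ (Fin h → ℚ)) : Set (Fin h → ℚ))
      = M2set β L := by
    intro v hv
    rw [← hMset]
    ext x
    constructor
    · rintro ⟨h1, h2⟩
      exact hNL v hv x h1 h2
    · intro hx
      exact ⟨hMN v hx, hML x hx⟩
  -- every neighbour contains a glue vector
  have hcontain : ∀ K : Submodule ℤ (Fin h → ℚ), IsUnimodularLattice β K →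
      ((K ⊓ L : Submodule ℤ (Fin h → ℚ)) : Set (Fin h → ℚ)) = M2set β L →
      u ∈ K ∨ u + e ∈ K := by
    intro K hK hKL
    have hmem : ∀ x, (x ∈ K ∧ x ∈ L) ↔ x ∈ M := by
      intro x
      have := Set.ext_iff.1 hKL x
      exact this
    have hMK : ∀ x ∈ M, x ∈ K := fun x hx => ((hmem x).2 hx).1
    have hex : ∃ x ∈ K, x ∉ L := by
      by_contra hcon
      push Not at hcon
      have heK : e ∈ K := by
        rw [hK]
        intro x hx
        exact hbInt he (hcon x hx)
      exact heM ((hmem e).1 ⟨heK, he⟩)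
    obtain ⟨x, hxK, hxL⟩ := hex
    have hxu : x - u ∈ L := (hdualM x (fun y hy => (hK x).1 hxK y (hMK y hy))).resolve_left hxL
    rcases hdich _ hxu with h1 | h1
    · left
      have := K.sub_mem hxK (hMK _ h1)
      rwa [sub_sub_cancel] at this
    · right
      have := K.sub_mem hxK (hMK _ h1)
      rwa [show x - (x - u - e) = u + e by abel] at this
  have heq : ∀ K : Submodule ℤ (Fin h → ℚ), IsUnimodularLattice β K →
      ((K ⊓ L : Submodule ℤ (Fin h → ℚ)) : Set (Fin h → ℚ)) = M2set β L →
      ∀ v, Good v → v ∈ K → K = N v := by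
    intro K hK hKL v hv hvK
    have hle : N v ≤ K := by
      refine sup_le ?_ ?_
      · intro x hx
        have h1 : x ∈ ((K ⊓ L : Submodule ℤ (Fin h → ℚ)) : Set (Fin h → ℚ)) := by
          rw [hKL]
          exact hx
        exact h1.1
      · rw [Submodule.span_le]
        simpa using hvK
    refine le_antisymm (fun x hx => ?_) hle
    rw [hNuni v hv]
    intro y hy
    exact (hK x).1 hx y (hle hy)
  refine ⟨⟨N u, N (u + e), ?_, ?_⟩, ?_⟩
  · intro hh
    apply heM
    refine hNL u hGu e ?_ he
    have h1 : u + e ∈ N u := by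
      rw [hh]
      exact hvN _
    have := (N u).sub_mem h1 (hvN u)
    rwa [add_sub_cancel_left] at this
  · ext K
    simp only [Set.mem_setOf_eq, Set.mem_insert_iff, Set.mem_singleton_iff]
    constructor
    · rintro ⟨hK, hKL⟩
      rcases hcontain K hK hKL with h1 | h1
      · exact Or.inl (heq K hK hKL u hGu h1)
      · exact Or.inr (heq K hK hKL _ hGue h1)
    · rintro (rfl | rfl)
      · exact ⟨hNuni _ hGu, hNinf _ hGu⟩
      · exact ⟨hNuni _ hGue, hNinf _ hGue⟩
  · intro K hK hKL
    rcases hcontain K hK hKL with h1 | h1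
    · exact ⟨u, h1, 2 * q + 1, ⟨q, rfl⟩, by rw [huu]; push_cast; ring⟩
    · obtain ⟨n, hn⟩ := hGue.2.2
      exact ⟨u + e, h1, 2 * n + 1, ⟨n, rfl⟩, by rw [hn]; push_cast; ring⟩
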